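/- arXiv:math/0202053 — 2 statements merged into one kernel-verified Lean document; each statement's English description precedes it below -/
import Mathlib

section
/- Let K be a real quadratic field, ε a fundamental unit of norm 1, and for n ≥ 1 let K_n = K(ζ_n, ε^{1/n}) and Z_n = K(ζ_n). Then [K_n : Z_n] ≥ n/2. -/
open IntermediateField

section RealBase

variable {K : IntermediateField ℚ ℂ}

/-- Complex conjugation as a `K`-automorphism of `ℂ`, for a subfield `K` of the reals. -/
noncomputable def conjOver (hK : ∀ x : K, (x : ℂ).im = 0) : ℂ ≃ₐ[K] ℂ :=
  AlgEquiv.ofRingEquiv (f := Complex.conjAe.toRingEquiv) fun x => by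
    show (starRingEnd ℂ) (x : ℂ) = x
    exact Complex.conj_eq_iff_im.mpr (hK x)

theorem conjOver_apply (hK : ∀ x : K, (x : ℂ).im = 0) (z : ℂ) :
    conjOver hK z = (starRingEnd ℂ) z := rfl

theorem conj_mem_of_normal (hK : ∀ x : K, (x : ℂ).im = 0) (Z : IntermediateField K ℂ)
    [Normal K Z] {z : ℂ} (hz : z ∈ Z) : (starRingEnd ℂ) z ∈ Z := by
  have h := AlgEquiv.restrictNormal_apply Z (conjOver hK) ⟨z, hz⟩
  rw [← conjOver_apply hK z, ← h]
  exact SetLike.coe_mem _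

/-- In an abelian extension of a real field, complex conjugation is central, so that conjugates of
real elements are real; a real radical therefore has at most the two conjugates `γ` and `-γ`. -/
theorem sq_mem_of_real_of_pow_mem (hK : ∀ x : K, (x : ℂ).im = 0) (Z : IntermediateField K ℂ)
    [FiniteDimensional K Z] [IsAbelianGalois K Z] {γ : ℂ} (hγ : γ ∈ Z) (hre : γ.im = 0)
    {m : ℕ} (hm : m ≠ 0) {a : K} (ha : γ ^ m = a) : ∃ b : K, (b : ℂ) = γ ^ 2 := by
  let c : Gal(Z/K) := (conjOver hK).restrictNormal Z
  have hc (x : Z) : ((c x : Z) : ℂ) = (starRingEnd ℂ) (x : ℂ) :=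
    AlgEquiv.restrictNormal_apply Z (conjOver hK) x
  let g : Z := ⟨γ, hγ⟩
  have hcg : c g = g := Subtype.ext <| by
    rw [hc]; exact Complex.conj_eq_iff_im.mpr hre
  have hga : g ^ m = algebraMap K Z a := Subtype.ext <| by simpa [g] using ha
  have hfix (σ : Gal(Z/K)) : σ (g ^ 2) = g ^ 2 := by
    have hreal : (starRingEnd ℂ) (σ g : ℂ) = (σ g : ℂ) := by
      rw [← hc]
      congr 1
      calc c (σ g) = (c * σ) g := rfl
        _ = (σ * c) g := by rw [mul_comm' c σ]
        _ = σ g := by rw [AlgEquiv.mul_apply, hcg]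
    have hpow : (σ g) ^ m = g ^ m := by rw [← map_pow, hga, AlgEquiv.commutes]
    obtain ⟨r, hr⟩ := Complex.conj_eq_iff_real.mp hreal
    obtain ⟨s, hs⟩ := Complex.conj_eq_iff_real.mp (Complex.conj_eq_iff_im.mpr hre)
    have hrs : r ^ m = s ^ m := by
      have := congrArg (Subtype.val : Z → ℂ) hpow
      push_cast at this
      rw [hr, show (g : ℂ) = s from hs] at this
      exact_mod_cast this
    have habs : |r| = |s| := by
      refine (pow_left_inj₀ (abs_nonneg _) (abs_nonneg _) hm).mp ?_
      rw [← abs_pow, ← abs_pow, hrs]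
    apply Subtype.ext
    rw [map_pow]
    push_cast
    rw [hr, show (g : ℂ) = s from hs]
    exact_mod_cast (sq_eq_sq_iff_abs_eq_abs r s).mpr habs
  obtain ⟨b, hb⟩ := IntermediateField.mem_bot.mp ((IsGalois.mem_bot_iff_fixed (g ^ 2)).mpr hfix)
  exact ⟨b, by simpa [g] using congrArg (Subtype.val : Z → ℂ) hb⟩

/-- A positive element of a real field that is a fourth power in an abelian extension containing
`I` is already a square. -/
theorem exists_sq_eq_of_fourth_power (hK : ∀ x : K, (x : ℂ).im = 0) (Z : IntermediateField K ℂ)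
    [FiniteDimensional K Z] [IsAbelianGalois K Z] (hI : Complex.I ∈ Z) {δ : ℂ} (hδ : δ ∈ Z)
    {t : K} (ht : δ ^ 4 = t) (hpos : 0 < (t : ℂ).re) : ∃ v : K, v ^ 2 = t := by
  have hre : δ.re * δ.im = 0 := by
    have him : (δ ^ 4).im = 0 := by rw [ht]; exact hK t
    rw [← ht] at hpos
    obtain ⟨x, y⟩ := δ
    simp only [pow_succ, pow_zero, one_mul, Complex.mul_re, Complex.mul_im] at him hpos ⊢
    have h1 : (x * y) * (x ^ 2 - y ^ 2) = 0 := by linarith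
    rcases mul_eq_zero.mp h1 with h | h
    · exact h
    · exfalso
      nlinarith [sq_nonneg (x * y), sq_nonneg (x ^ 2 - y ^ 2), sq_nonneg (x ^ 2 + y ^ 2)]
  rcases mul_eq_zero.mp hre with h | h
  · obtain ⟨b, hb⟩ := sq_mem_of_real_of_pow_mem hK Z (mul_mem hI hδ) (by simp [h])
      (m := 4) (by norm_num) (a := t) (by rw [mul_pow, Complex.I_pow_four, one_mul, ht])
    refine ⟨b, Subtype.ext ?_⟩
    push_cast
    rw [hb, ← ht, ← pow_mul, mul_pow, Complex.I_pow_four, one_mul]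
  · obtain ⟨b, hb⟩ := sq_mem_of_real_of_pow_mem hK Z hδ h (m := 4) (by norm_num) ht
    refine ⟨b, Subtype.ext ?_⟩
    push_cast
    rw [hb, ← ht, ← pow_mul]

end RealBase

/-- A number field with more than one infinite place has a unit of infinite
order. -/
theorem exists_unit_not_torsion (K : Type*) [Field K] [NumberField K]
    (h : 1 < Fintype.card (NumberField.InfinitePlace K)) :
    ∃ u : (NumberField.RingOfIntegers K)ˣ, u ∉ NumberField.Units.torsion K := by
  have hr : 0 < NumberField.Units.rank K := by
    unfold NumberField.Units.rank; omega
  refine ⟨NumberField.Units.fundSystem K ⟨0, hr⟩, fun hu => ?_⟩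
  obtain ⟨x, -, hx⟩ := NumberField.Units.exist_unique_eq_mul_prod K
    (NumberField.Units.fundSystem K ⟨0, hr⟩)
  have h0 := (hx (⟨_, hu⟩, 0) (by simp)).trans
    (hx (1, Pi.single ⟨0, hr⟩ 1) (by
      have hsum := Fintype.prod_eq_single (f := fun i => NumberField.Units.fundSystem K i ^
        (Pi.single ⟨0, hr⟩ 1 : Fin (NumberField.Units.rank K) → ℤ) i) ⟨0, hr⟩
        fun j hj => by simp [hj]
      simp [hsum])).symm
  simpa using congrFun (congrArg Prod.snd h0) ⟨0, hr⟩

theorem one_lt_card_infinitePlace_of_real {K : IntermediateField ℚ ℂ} [NumberField K]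
    (hK2 : Module.finrank ℚ K = 2) (hK : ∀ x : K, (x : ℂ).im = 0) :
    1 < Fintype.card (NumberField.InfinitePlace K) := by
  have hreal : NumberField.ComplexEmbedding.IsReal (algebraMap K ℂ) := by
    refine RingHom.ext fun x => ?_
    exact Complex.conj_eq_iff_im.mpr (hK x)
  have hpos : 0 < NumberField.InfinitePlace.nrRealPlaces K :=
    by
    classical
    exact Fintype.card_pos_iff.mpr
      ⟨⟨NumberField.InfinitePlace.mk (algebraMap K ℂ), ⟨_, hreal, rfl⟩⟩⟩
  have h1 := NumberField.InfinitePlace.card_add_two_mul_card_eq_rank K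
  have h2 := NumberField.InfinitePlace.card_eq_nrRealPlaces_add_nrComplexPlaces K
  omega

theorem fundamental_unit_pow_ne_one {K : Type*} [Field K] [NumberField K]
    (h : 1 < Fintype.card (NumberField.InfinitePlace K)) {ε : K}
    (hfund : ∀ u : K, IsIntegral ℤ u → IsIntegral ℤ (u⁻¹ : K) →
      ∃ k : ℤ, u = ε ^ k ∨ u = -ε ^ k) {N : ℕ} (hN : N ≠ 0) : ε ^ N ≠ 1 := by
  intro h1
  obtain ⟨w, hw⟩ := exists_unit_not_torsion K h
  apply hw
  rw [NumberField.Units.torsion, CommGroup.mem_torsion, isOfFinOrder_iff_pow_eq_one]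
  refine ⟨2 * N, by omega, ?_⟩
  have hinv : ((w : NumberField.RingOfIntegers K) : K)⁻¹ =
      ((w⁻¹ : (NumberField.RingOfIntegers K)ˣ) : NumberField.RingOfIntegers K) := by
    apply inv_eq_of_mul_eq_one_right
    rw [← map_mul]
    simp
  obtain ⟨k, hk⟩ := hfund ((w : NumberField.RingOfIntegers K) : K)
    (NumberField.RingOfIntegers.isIntegral_coe _)
    (by rw [hinv]; exact NumberField.RingOfIntegers.isIntegral_coe _)
  have h2 : (((w : NumberField.RingOfIntegers K) : K)) ^ 2 = ε ^ (k * 2) := by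
    rcases hk with hk | hk <;> rw [hk, zpow_mul] <;> norm_cast
    rw [neg_sq]
  apply Units.ext
  apply NumberField.RingOfIntegers.ext
  rw [Units.val_pow_eq_pow_val, Units.val_one]
  change algebraMap _ K ((w : NumberField.RingOfIntegers K) ^ (2 * N)) = algebraMap _ K 1
  rw [map_pow, map_one, pow_mul]
  rw [h2, ← zpow_natCast, ← zpow_mul, mul_comm, zpow_mul, zpow_natCast, h1, one_zpow]

theorem fundamental_unit_sq_mem_zpow {K : Type*} [Field K] {ε : K}
    (hfund : ∀ u : K, IsIntegral ℤ u → IsIntegral ℤ (u⁻¹ : K) →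
      ∃ k : ℤ, u = ε ^ k ∨ u = -ε ^ k)
    (hεint : IsIntegral ℤ ε) (hεinv : IsIntegral ℤ ε⁻¹) {u : K} {m a : ℕ} (hm : m ≠ 0)
    (hu : u ^ m = ε ^ a ∨ u ^ m = -ε ^ a) : ∃ k : ℤ, u ^ 2 = ε ^ (2 * k) := by
  have hint : IsIntegral ℤ u := by
    refine IsIntegral.of_pow (Nat.pos_of_ne_zero hm) ?_
    rcases hu with hu | hu <;> rw [hu]
    · exact hεint.pow a
    · exact (hεint.pow a).neg
  have hinv : IsIntegral ℤ u⁻¹ := by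
    refine IsIntegral.of_pow (Nat.pos_of_ne_zero hm) ?_
    rw [inv_pow]
    rcases hu with hu | hu <;> rw [hu]
    · rw [← inv_pow]; exact hεinv.pow a
    · rw [inv_neg, ← inv_pow]; exact (hεinv.pow a).neg
  obtain ⟨k, hk⟩ := hfund u hint hinv
  refine ⟨k, ?_⟩
  rw [mul_comm, zpow_mul]
  rcases hk with hk | hk <;> rw [hk] <;> norm_cast
  rw [neg_sq]

/-- An `m`-th root of a fundamental unit lies in an abelian extension of the real quadratic field
only for `m ≤ 2`. -/
theorem le_two_of_pow_eq_fundamental_unit {K : IntermediateField ℚ ℂ}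
    (hK2 : Module.finrank ℚ K = 2) (hK : ∀ x : K, (x : ℂ).im = 0)
    {ε : K} (hε0 : ε ≠ 0) (hεint : IsIntegral ℤ ε) (hεinv : IsIntegral ℤ (ε⁻¹ : K))
    (hfund : ∀ u : K, IsIntegral ℤ u → IsIntegral ℤ (u⁻¹ : K) →
      ∃ k : ℤ, u = ε ^ k ∨ u = -ε ^ k) (Z : IntermediateField K ℂ)
    [FiniteDimensional K Z] [IsAbelianGalois K Z] {m : ℕ} (hI : 4 ∣ m → Complex.I ∈ Z)
    {β : ℂ} (hβ : β ∈ Z) (hβm : β ^ m = ε) (hm : m ≠ 0) : m ≤ 2 := by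
  have : FiniteDimensional ℚ K := FiniteDimensional.of_finrank_pos (by omega)
  have : NumberField K := { }
  have hne := fun {N : ℕ} (hN : N ≠ 0) =>
    fundamental_unit_pow_ne_one (one_lt_card_infinitePlace_of_real hK2 hK) hfund hN
  have hzpow {a b : ℤ} (h : ε ^ a = ε ^ b) : a = b := by
    by_contra hab
    have h1 : ε ^ (a - b) = 1 := by rw [zpow_sub₀ hε0, h, div_self (zpow_ne_zero _ hε0)]
    refine hne (N := (a - b).natAbs) (by omega) ?_
    rcases Int.natAbs_eq (a - b) with h2 | h2 <;> rw [h2] at h1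
    · exact_mod_cast h1
    · rw [zpow_neg, inv_eq_one] at h1
      exact_mod_cast h1
  have hεconj : (starRingEnd ℂ) (ε : ℂ) = ε := Complex.conj_eq_iff_im.mpr (hK ε)
  have hρm : (β * (starRingEnd ℂ) β) ^ m = ((ε ^ 2 : K) : ℂ) := by
    rw [mul_pow, ← map_pow, hβm, hεconj]; push_cast; ring
  obtain ⟨b, hb⟩ := sq_mem_of_real_of_pow_mem hK Z (mul_mem hβ (conj_mem_of_normal hK Z hβ))
    (by rw [Complex.mul_conj]; exact Complex.ofReal_im _) hm hρm
  have hbm : b ^ m = ε ^ 4 := Subtype.ext <| by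
    push_cast
    rw [hb, ← pow_mul, mul_comm 2 m, pow_mul, hρm]; push_cast; ring
  obtain ⟨k, hk⟩ := fundamental_unit_sq_mem_zpow hfund hεint hεinv hm (Or.inl hbm)
  have hkm : 2 * k * m = 8 := by
    apply hzpow
    rw [zpow_mul, ← hk, zpow_natCast, ← pow_mul, mul_comm 2 m, pow_mul, hbm, ← pow_mul]
    norm_cast
  have hdvd : m ∣ 4 := by
    zify
    exact ⟨k, by linarith⟩
  have hle := Nat.le_of_dvd (by norm_num) hdvd
  by_contra hgt
  obtain rfl : m = 4 := by interval_cases m <;> omega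
  have hI := hI dvd_rfl
  have hfinish (u : K) (hu : u ^ 2 = ε ∨ u ^ 2 = -ε) : False := by
    obtain ⟨j, hj⟩ := fundamental_unit_sq_mem_zpow hfund hεint hεinv (a := 1) two_ne_zero
      (by simpa using hu)
    have h4 : ε ^ (4 * j) = ε ^ (2 : ℤ) := by
      rw [show 4 * j = 2 * j * 2 by ring, zpow_mul, ← hj]
      rcases hu with hu | hu <;> rw [hu]
      norm_cast
      rw [neg_sq]
    have := hzpow h4
    omega
  have hεre : (ε : ℂ).re ≠ 0 := fun h => hε0 <| Subtype.ext <| Complex.ext h (hK ε)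
  rcases lt_or_gt_of_ne hεre with hneg | hpos
  · have h1I : (1 + Complex.I) ^ 4 = -4 := by
      rw [show (1 + Complex.I) ^ 4 = (1 + 2 * Complex.I + Complex.I ^ 2) ^ 2 by ring,
        Complex.I_sq]
      ring_nf
      rw [Complex.I_sq]; norm_num
    have hcoe : ((-ε / 4 : K) : ℂ) = -(ε : ℂ) / 4 := by
      simp only [IntermediateField.coe_div, IntermediateField.coe_neg]; rfl
    obtain ⟨v, hv⟩ := exists_sq_eq_of_fourth_power hK Z hI
      (div_mem hβ (add_mem (one_mem Z) hI)) (t := -ε / 4)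
      (by rw [div_pow, hβm, h1I, hcoe]; ring)
      (by rw [hcoe,
            show -(ε : ℂ) / 4 = ((1 / 4 : ℝ) : ℂ) * (-(ε : ℂ)) by push_cast; ring,
            Complex.re_ofReal_mul, Complex.neg_re]
          linarith)
    exact hfinish (2 * v) (Or.inr (by rw [mul_pow, hv]; ring))
  · obtain ⟨v, hv⟩ := exists_sq_eq_of_fourth_power hK Z hI hβ hβm hpos
    exact hfinish v (Or.inl hv)

/-- If `F` contains the ratios of all `n`-th roots of `a`, then the power of such a root `α` given
by the degree of `α` over `F` lies in `F`. -/
theorem pow_natDegree_minpoly_mem {k L : Type*} [Field k] [Field L] [Algebra k L] [IsAlgClosed L]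
    (F : IntermediateField k L) {n : ℕ} (hn : n ≠ 0) {ζ α : L} (hζ : IsPrimitiveRoot ζ n)
    (hζF : ζ ∈ F) (hα0 : α ≠ 0) (hα : α ^ n ∈ F) : α ^ (minpoly F α).natDegree ∈ F := by
  have : NeZero n := ⟨hn⟩
  have hint : IsIntegral F α := by
    refine IsIntegral.of_pow (Nat.pos_of_ne_zero hn) ?_
    exact isIntegral_algebraMap (R := F) (x := ⟨α ^ n, hα⟩)
  set p := (minpoly F α).map (algebraMap F L) with hp
  have hmonic : p.Monic := (minpoly.monic hint).map _
  have hsplit : p.Splits := IsAlgClosed.splits p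
  have hroot : ∀ r ∈ p.roots, r / α ∈ F := by
    intro r hr
    have hdvd : minpoly F α ∣ Polynomial.X ^ n - Polynomial.C (⟨α ^ n, hα⟩ : F) := by
      apply minpoly.dvd
      simp [IntermediateField.algebraMap_apply]
    have hrn : r ^ n = α ^ n := by
      have h0 : Polynomial.aeval r (minpoly F α) = 0 := by
        have := (Polynomial.mem_roots'.mp hr).2
        rwa [Polynomial.IsRoot.def, hp, Polynomial.eval_map_algebraMap] at this
      have := Polynomial.aeval_eq_zero_of_dvd_aeval_eq_zero hdvd h0
      simpa [IntermediateField.algebraMap_apply, sub_eq_zero] using this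
    obtain ⟨i, -, hi⟩ := hζ.eq_pow_of_pow_eq_one (ξ := r / α)
      (by rw [div_pow, hrn, div_self (pow_ne_zero _ hα0)])
    rw [← hi]
    exact pow_mem hζF i
  have hprod : p.roots.prod / α ^ p.roots.card ∈ F := by
    revert hroot
    generalize p.roots = s
    induction s using Multiset.induction_on with
    | empty => intro _; simp
    | cons a s ih =>
      intro h
      rw [Multiset.prod_cons, Multiset.card_cons, pow_succ', mul_div_mul_comm]
      exact mul_mem (h a (Multiset.mem_cons_self a s))
        (ih fun r hr => h r (Multiset.mem_cons_of_mem hr))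
  have hcard : p.roots.card = (minpoly F α).natDegree := by
    rw [← hsplit.natDegree_eq_card_roots, hp, Polynomial.natDegree_map]
  have hcoeff : p.roots.prod ∈ F := by
    have h := hsplit.coeff_zero_eq_prod_roots_of_monic hmonic
    have hc : p.coeff 0 ∈ F := by
      rw [hp, Polynomial.coeff_map]
      exact SetLike.coe_mem _
    have : p.roots.prod = (-1) ^ p.natDegree * p.coeff 0 := by
      rw [h, ← mul_assoc, ← mul_pow]; simp
    rw [this]
    exact mul_mem (pow_mem (neg_mem (one_mem F)) _) hc
  rw [hcard] at hprod
  have hne : p.roots.prod ≠ 0 := by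
    rw [Ne, Multiset.prod_eq_zero_iff]
    intro h0
    have h1 := (Polynomial.mem_roots'.mp h0).2
    rw [Polynomial.IsRoot.def, hp, Polynomial.eval_map_algebraMap] at h1
    have h2 := minpoly.coeff_zero_ne_zero hint hα0
    rw [Polynomial.aeval_def, Polynomial.eval₂_at_zero] at h1
    exact h2 (by simpa using h1)
  have := div_mem hcoeff hprod
  rwa [div_div_cancel₀ hne] at this

theorem pow_gcd_mem {k L : Type*} [Field k] [Field L] [Algebra k L] (F : IntermediateField k L)
    {α : L} (hα0 : α ≠ 0) {d n : ℕ} (hd : α ^ d ∈ F) (hn : α ^ n ∈ F) : α ^ d.gcd n ∈ F := by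
  rw [← zpow_natCast, Nat.gcd_eq_gcd_ab, zpow_add₀ hα0, zpow_mul, zpow_mul, zpow_natCast,
    zpow_natCast]
  exact mul_mem (zpow_mem hd _) (zpow_mem hn _)

/-- Let `K ⊂ ℂ` be a real quadratic field, `ε` a fundamental unit of norm 1,
and for `n ≥ 1` let `Z_n = K(ζ_n)` and `K_n = K(ζ_n, ε^{1/n})` with
`ζ_n = e^{2πi/n}`.  Then `[K_n : Z_n] ≥ n/2`. -/
theorem kummer_degree_lower_bound (K : IntermediateField ℚ ℂ)
    (hK2 : Module.finrank ℚ K = 2) (hKreal : ∀ x : K, (x : ℂ).im = 0)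
    (ε : K) (hεint : IsIntegral ℤ ε) (hεinv : IsIntegral ℤ (ε⁻¹ : K))
    (hnorm : Algebra.norm ℚ ε = 1)
    (hfund : ∀ u : K, IsIntegral ℤ u → IsIntegral ℤ (u⁻¹ : K) →
      ∃ k : ℤ, u = ε ^ k ∨ u = -ε ^ k)
    (n : ℕ) (hn : 1 ≤ n)
    (ζ : ℂ) (hζ : ζ = Complex.exp (2 * (Real.pi : ℂ) * Complex.I / n))
    (α : ℂ) (hα : α ^ n = (ε : ℂ)) :
    n * Module.finrank ℚ (K ⊔ adjoin ℚ {ζ} : IntermediateField ℚ ℂ) ≤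
      2 * Module.finrank ℚ (K ⊔ adjoin ℚ {ζ, α} : IntermediateField ℚ ℂ) := by
  have hn0 : n ≠ 0 := by omega
  have : NeZero n := ⟨hn0⟩
  have hprim : IsPrimitiveRoot ζ n := hζ ▸ Complex.isPrimitiveRoot_exp n hn0
  have : FiniteDimensional ℚ K := FiniteDimensional.of_finrank_pos (by omega)
  have : IsCyclotomicExtension {n} K K⟮ζ⟯ :=
    (IntermediateField.isCyclotomicExtension_singleton_iff_eq_adjoin n K ℂ K⟮ζ⟯ hprim).mpr rfl
  have : FiniteDimensional K K⟮ζ⟯ := IsCyclotomicExtension.finiteDimensional {n} K K⟮ζ⟯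
  have : IsAbelianGalois K K⟮ζ⟯ := IsCyclotomicExtension.isAbelianGalois {n} K K⟮ζ⟯
  have hζZ : ζ ∈ K⟮ζ⟯ := mem_adjoin_simple_self K ζ
  have hε0 : ε ≠ 0 := by
    rintro rfl
    simp [Algebra.norm_zero] at hnorm
  have hα0 : α ≠ 0 := by
    rintro rfl
    rw [zero_pow hn0] at hα
    exact hε0 (Subtype.ext hα.symm)
  have hαn : α ^ n ∈ K⟮ζ⟯ := by
    rw [hα]; exact IntermediateField.algebraMap_mem K⟮ζ⟯ ε
  have hint : IsIntegral K⟮ζ⟯ α := by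
    refine IsIntegral.of_pow (Nat.pos_of_ne_zero hn0) ?_
    exact isIntegral_algebraMap (R := K⟮ζ⟯) (x := ⟨α ^ n, hαn⟩)
  have hdeg : n ≤ 2 * Module.finrank K⟮ζ⟯ K⟮ζ⟯⟮α⟯ := by
    rw [adjoin.finrank hint]
    set d := (minpoly K⟮ζ⟯ α).natDegree
    have hd0 : 0 < d := minpoly.natDegree_pos hint
    have hg := pow_gcd_mem K⟮ζ⟯ hα0
      (pow_natDegree_minpoly_mem K⟮ζ⟯ hn0 hprim hζZ hα0 hαn) hαn
    obtain ⟨m, hm⟩ := Nat.gcd_dvd_right d n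
    have hm0 : m ≠ 0 := by
      rintro rfl
      omega
    have hle := le_two_of_pow_eq_fundamental_unit hK2 hKreal hε0 hεint hεinv hfund K⟮ζ⟯ (m := m)
      (fun h4 => by
        obtain ⟨q, hq⟩ := h4.trans (Dvd.intro_left _ hm.symm)
        have hI4 := hprim.pow (Nat.pos_of_ne_zero hn0) (a := q) (b := 4) (by rw [hq, mul_comm])
        obtain ⟨i, -, hi⟩ := hI4.eq_pow_of_pow_eq_one Complex.I_pow_four
        rw [← hi]
        exact pow_mem (pow_mem hζZ q) i)
      hg (by rw [← pow_mul, ← hm, hα]) hm0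
    have hgd : d.gcd n ≤ d := Nat.gcd_le_left n hd0
    calc n = d.gcd n * m := hm
      _ ≤ d * 2 := Nat.mul_le_mul hgd hle
      _ = 2 * d := mul_comm _ _
  rw [← restrictScalars_adjoin_eq_sup, ← restrictScalars_adjoin_eq_sup,
    ← adjoin_simple_adjoin_simple]
  change n * Module.finrank ℚ K⟮ζ⟯ ≤ 2 * Module.finrank ℚ K⟮ζ⟯⟮α⟯
  rw [← Module.finrank_mul_finrank ℚ K⟮ζ⟯ K⟮ζ⟯⟮α⟯]
  nlinarith [Nat.mul_le_mul_right (Module.finrank ℚ K⟮ζ⟯) hdeg]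
end

section
/- Let K be a real quadratic field, ε a unit of K of norm 1 and infinite order, K_n = K(ζ_n, ε^{1/n}). Then there are constants c, C > 0 (depending on ε) such that c · n · φ(n) ≤ [K_n : Q] ≤ 2 n φ(n) for all n ≥ 1, where φ is Euler's totient function. -/
open IntermediateField

/-- The degree of a simple extension `L(a)` over the base of `L`. -/
theorem IntermediateField.finrank_sup_adjoin_simple {F E : Type*} [Field F] [Field E] [Algebra F E]
    (L : IntermediateField F E) {a : E} (ha : IsIntegral L a) :
    Module.finrank F (L ⊔ F⟮a⟯ : IntermediateField F E) =
      Module.finrank F L * (minpoly L a).natDegree := by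
  rw [← restrictScalars_adjoin_eq_sup, ← adjoin.finrank ha]
  exact (Module.finrank_mul_finrank F L L⟮a⟯).symm

/-- An element of norm one in a quadratic extension is a root of `X ^ 2 + b X + 1`. -/
theorem exists_sq_add_mul_add_one_eq_zero_of_norm_eq_one {F K : Type*} [Field F] [Field K]
    [Algebra F K] (hK : Module.finrank F K = 2) {x : K} (hx : Algebra.norm F x = 1) :
    ∃ b : F, x ^ 2 + algebraMap F K b * x + 1 = 0 := by
  have : FiniteDimensional F K := Module.finite_of_finrank_pos (by omega)
  have hdeg : (Algebra.lmul F K x).charpoly.natDegree = 2 := by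
    rw [LinearMap.charpoly_natDegree, hK]
  have hmonic := (Algebra.lmul F K x).charpoly_monic
  have hcoeff : (Algebra.lmul F K x).charpoly.coeff 0 = 1 := by
    have h := LinearMap.det_eq_sign_charpoly_coeff (Algebra.lmul F K x)
    rw [hK, ← Algebra.norm_apply, hx] at h
    simpa using h.symm
  have haeval := LinearMap.aeval_self_charpoly (Algebra.lmul F K x)
  rw [Polynomial.aeval_algHom_apply] at haeval
  have h0 := (Algebra.lmul_injective (R := F) (A := K)) (haeval.trans (map_zero _).symm)
  have hlead : (Algebra.lmul F K x).charpoly.coeff 2 = 1 := by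
    rw [← hdeg]; exact hmonic.coeff_natDegree
  refine ⟨(Algebra.lmul F K x).charpoly.coeff 1, ?_⟩
  rw [Polynomial.aeval_eq_sum_range, hdeg, Finset.sum_range_succ, Finset.sum_range_succ,
    Finset.sum_range_one, hcoeff, hlead] at h0
  simp only [Algebra.smul_def, pow_zero, pow_one, map_one] at h0
  linear_combination h0

/-- Complex conjugation on the algebraic numbers. -/
noncomputable def algebraicConj : algebraicClosure ℚ ℂ →ₐ[ℚ] algebraicClosure ℚ ℂ :=
  ((Complex.conjAe.toAlgHom.restrictScalars ℚ).comp (algebraicClosure ℚ ℂ).val).codRestrict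
    (algebraicClosure ℚ ℂ).toSubalgebra fun x =>
      (map_mem_algebraicClosure_iff (Complex.conjAe.toAlgHom.restrictScalars ℚ)).2 x.2

/-- If an embedding of the algebraic numbers commutes with complex conjugation on a set of
algebraic numbers, then it does so on the field generated by that set. -/
theorem map_algebraicConj_of_mem_adjoin (τ : algebraicClosure ℚ ℂ →ₐ[ℚ] ℂ) {S : Set ℂ}
    (hS : ∀ x ∈ S, ∃ z : algebraicClosure ℚ ℂ,
      (z : ℂ) = x ∧ τ (algebraicConj z) = (starRingEnd ℂ) (τ z))
    (z : algebraicClosure ℚ ℂ) (hz : (z : ℂ) ∈ adjoin ℚ S) :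
    τ (algebraicConj z) = (starRingEnd ℂ) (τ z) := by
  suffices ∀ x ∈ adjoin ℚ S, ∃ z : algebraicClosure ℚ ℂ,
      (z : ℂ) = x ∧ τ (algebraicConj z) = (starRingEnd ℂ) (τ z) by
    obtain ⟨w, hw, h⟩ := this z hz
    rwa [← Subtype.ext hw]
  intro x hx
  induction hx using adjoin_induction with
  | mem x hx => exact hS x hx
  | algebraMap q => exact ⟨algebraMap ℚ _ q, rfl, by simp⟩
  | add x y _ _ hx hy =>
    obtain ⟨a, rfl, ha⟩ := hx
    obtain ⟨b, rfl, hb⟩ := hy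
    exact ⟨a + b, rfl, by simp only [map_add, ha, hb]⟩
  | inv x _ hx =>
    obtain ⟨a, rfl, ha⟩ := hx
    exact ⟨a⁻¹, rfl, by simp only [map_inv₀, ha]⟩
  | mul x y _ _ hx hy =>
    obtain ⟨a, rfl, ha⟩ := hx
    obtain ⟨b, rfl, hb⟩ := hy
    exact ⟨a * b, rfl, by simp only [map_mul, ha, hb]⟩

/-- An algebraic number fixed by every embedding into `ℂ` is rational. -/
theorem exists_rat_eq_of_forall_algHom (t : algebraicClosure ℚ ℂ)
    (h : ∀ τ : algebraicClosure ℚ ℂ →ₐ[ℚ] ℂ, τ t = t) : ∃ q : ℚ, (q : ℂ) = t := by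
  have hint : IsIntegral ℚ (t : ℂ) := mem_algebraicClosure_iff'.1 t.2
  by_contra! hq
  have hnot : (t : ℂ) ∉ (⊥ : Subalgebra ℚ ℂ) := by
    rintro hmem
    obtain ⟨q, hq'⟩ := Algebra.mem_bot.1 hmem
    exact hq q (by simpa using hq')
  obtain ⟨y, hne, hconj⟩ := (notMem_iff_exists_ne_and_isConjRoot
    (minpoly.irreducible hint).separable (IsAlgClosed.splits _)).1 hnot
  obtain ⟨τ, hτ⟩ := exists_algHom_of_splits_of_aeval (F := ℚ) (E := algebraicClosure ℚ ℂ)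
    (K := ℂ) (x := t) (y := y)
    (fun s => ⟨(isIntegral_algHom_iff (algebraicClosure ℚ ℂ).val Subtype.val_injective).1
      (mem_algebraicClosure_iff'.1 s.2), IsAlgClosed.splits _⟩) (by
      rw [← minpoly.algHom_eq (algebraicClosure ℚ ℂ).val Subtype.val_injective]
      exact (isConjRoot_iff_aeval_eq_zero hint).1 hconj)
  exact hne ((h τ).symm.trans hτ)

/-- A positive real `r ≠ 1` with `r + r⁻¹` an integer has `r ≥ 2` or `r⁻¹ ≥ 2`. -/
theorem log_two_le_abs_log_of_add_inv_eq_int {r : ℝ} (hr : 0 < r) (hr1 : r ≠ 1) {m : ℤ}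
    (hm : r + r⁻¹ = m) : Real.log 2 ≤ |Real.log r| := by
  have h2 : (2 : ℝ) < m := by
    rw [← hm]
    have : 0 < (r - 1) ^ 2 := by positivity [sub_ne_zero.2 hr1]
    field_simp
    nlinarith
  have h3 : (3 : ℝ) ≤ m := by
    exact_mod_cast (show (2 : ℤ) < m by exact_mod_cast h2)
  rcases le_total 1 r with h | h
  · have : r⁻¹ ≤ 1 := inv_le_one_of_one_le₀ h
    exact (Real.log_le_log two_pos (by linarith)).trans (le_abs_self _)
  · rw [← abs_neg, ← Real.log_inv]
    exact (Real.log_le_log two_pos (by linarith)).trans (le_abs_self _)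

/-- If `ε` is a real unit which is a root of `X ^ 2 + b X + 1` and `β ∈ ℚ(ζ_n, ε)` satisfies
`β ^ (2n) = ε ^ (2d)`, then `d / n` is bounded below in terms of `ε` only: the number `β β̄` has
only itself and its inverse as conjugates, so its sum with its inverse is an integer
greater than `2`. -/
theorem mul_log_two_le_of_pow_eq {e : ℝ} {b : ℚ} (hb : e ^ 2 + b * e + 1 = 0) (he1 : |e| ≠ 1)
    (heint : IsIntegral ℤ (e : ℂ)) (heinv : IsIntegral ℤ ((e : ℂ)⁻¹)) {n d : ℕ} (hn : n ≠ 0)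
    (hd : d ≠ 0) {ζ β : ℂ} (hζ : ζ ^ n = 1) (hβ : β ∈ adjoin ℚ {ζ, (e : ℂ)})
    (hpow : β ^ (2 * n) = (e : ℂ) ^ (2 * d)) :
    n * Real.log 2 ≤ 2 * d * |(Real.log |e|)| := by
  have hn2 : 2 * n ≠ 0 := by omega
  have he0 : e ≠ 0 := by rintro rfl; norm_num at hb
  have hb' : (e : ℂ) ^ 2 + b * e + 1 = 0 := by exact_mod_cast congrArg (Complex.ofReal) hb
  have hζint : IsIntegral ℤ ζ := .of_pow (Nat.pos_of_ne_zero hn) (hζ ▸ isIntegral_one)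
  have hβint : IsIntegral ℤ β := .of_pow (Nat.pos_of_ne_zero hn2) (hpow ▸ heint.pow _)
  have hβinv : IsIntegral ℤ β⁻¹ :=
    .of_pow (Nat.pos_of_ne_zero hn2) (by rw [inv_pow, hpow, ← inv_pow]; exact heinv.pow _)
  have halg {x : ℂ} (hx : IsIntegral ℤ x) : x ∈ algebraicClosure ℚ ℂ :=
    mem_algebraicClosure_iff'.2 hx.tower_top
  let ζ' : algebraicClosure ℚ ℂ := ⟨ζ, halg hζint⟩
  let e' : algebraicClosure ℚ ℂ := ⟨e, halg heint⟩
  let β' : algebraicClosure ℚ ℂ := ⟨β, halg hβint⟩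
  have hβpow' : β' ^ (2 * n) = e' ^ (2 * d) := Subtype.ext hpow
  have hτe (τ : algebraicClosure ℚ ℂ →ₐ[ℚ] ℂ) : τ e' = e ∨ τ e' = (e : ℂ)⁻¹ := by
    have h : e' ^ 2 + algebraMap ℚ _ b * e' + 1 = 0 := Subtype.ext (by simpa [e'] using hb')
    have h' : (τ e') ^ 2 + b * τ e' + 1 = 0 := by
      have := congrArg τ h
      simpa using this
    have hc : (e : ℂ) ≠ 0 := by exact_mod_cast he0
    have : (τ e' - e) * (τ e' * e - 1) = 0 := by linear_combination e * h' - τ e' * hb'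
    rcases mul_eq_zero.1 this with h | h
    · exact .inl (sub_eq_zero.1 h)
    · exact .inr (eq_inv_of_mul_eq_one_left (sub_eq_zero.1 h))
  have hcomm (τ : algebraicClosure ℚ ℂ →ₐ[ℚ] ℂ) :
      τ (algebraicConj β') = (starRingEnd ℂ) (τ β') := by
    refine map_algebraicConj_of_mem_adjoin τ (S := {ζ, (e : ℂ)}) ?_ β' hβ
    rintro x (rfl | rfl)
    · refine ⟨ζ', rfl, ?_⟩
      have hz : ζ' ^ n = 1 := Subtype.ext hζ
      have h1 : algebraicConj ζ' = ζ'⁻¹ := Subtype.ext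
        (Complex.inv_eq_conj (Complex.norm_eq_one_of_pow_eq_one hζ hn)).symm
      have h2 : (τ ζ') ^ n = 1 := by rw [← map_pow, hz, map_one]
      rw [h1, map_inv₀, Complex.inv_eq_conj (Complex.norm_eq_one_of_pow_eq_one h2 hn)]
    · refine ⟨e', rfl, ?_⟩
      have h1 : algebraicConj e' = e' := Subtype.ext (Complex.conj_ofReal e)
      rw [h1]
      rcases hτe τ with h | h <;> simp [h]
  have hnormβ : ‖β‖ ^ (2 * n) = |e| ^ (2 * d) := by
    rw [← norm_pow, hpow, norm_pow, Complex.norm_real, Real.norm_eq_abs]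
  have hβ0 : β ≠ 0 := by
    rintro rfl
    rw [norm_zero, zero_pow hn2] at hnormβ
    exact pow_ne_zero _ (abs_ne_zero.2 he0) hnormβ.symm
  have hτβ (τ : algebraicClosure ℚ ℂ →ₐ[ℚ] ℂ) : ‖τ β'‖ = ‖β‖ ∨ ‖τ β'‖ = ‖β‖⁻¹ := by
    have h : ‖τ β'‖ ^ (2 * n) = ‖τ e'‖ ^ (2 * d) := by
      rw [← norm_pow, ← map_pow, hβpow', map_pow, norm_pow]
    rcases hτe τ with h1 | h1
    · left
      rw [h1, Complex.norm_real, Real.norm_eq_abs, ← hnormβ] at h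
      exact (pow_left_inj₀ (norm_nonneg _) (norm_nonneg _) hn2).1 h
    · right
      rw [h1, norm_inv, Complex.norm_real, Real.norm_eq_abs, inv_pow, ← hnormβ, ← inv_pow] at h
      exact (pow_left_inj₀ (norm_nonneg _) (by positivity) hn2).1 h
  let r' := β' * algebraicConj β'
  have hτr (τ : algebraicClosure ℚ ℂ →ₐ[ℚ] ℂ) : τ r' = ((‖τ β'‖ ^ 2 : ℝ) : ℂ) := by
    rw [map_mul, hcomm, Complex.mul_conj, Complex.normSq_eq_norm_sq]
  have hr : (r' : ℂ) = ((‖β‖ ^ 2 : ℝ) : ℂ) := hτr (algebraicClosure ℚ ℂ).val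
  obtain ⟨q, hq⟩ := exists_rat_eq_of_forall_algHom (r' + r'⁻¹) fun τ => by
    rw [map_add, map_inv₀, hτr]
    change _ = (r' : ℂ) + (r' : ℂ)⁻¹
    rw [hr]
    rcases hτβ τ with h | h
    · rw [h]
    · rw [h]
      push_cast
      rw [inv_pow, inv_inv, add_comm]
  have hconjint {x : ℂ} (hx : IsIntegral ℤ x) : IsIntegral ℤ ((starRingEnd ℂ) x) :=
    hx.map (starRingEnd ℂ).toIntAlgHom
  have hqint : IsIntegral ℤ (q : ℂ) := by
    rw [hq]
    change IsIntegral ℤ (β * (starRingEnd ℂ) β + (β * (starRingEnd ℂ) β)⁻¹)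
    rw [mul_inv, ← map_inv₀]
    exact (hβint.mul (hconjint hβint)).add (hβinv.mul (hconjint hβinv))
  have hqint' : IsIntegral ℤ q := (isIntegral_algebraMap_iff (A := ℚ) (B := ℂ)
    (algebraMap ℚ ℂ).injective).1 (by simpa using hqint)
  obtain ⟨m, hm⟩ := IsIntegrallyClosed.isIntegral_iff.1 hqint'
  have hrm : ‖β‖ ^ 2 + (‖β‖ ^ 2)⁻¹ = m := by
    have h : ((‖β‖ ^ 2 : ℝ) : ℂ) + ((‖β‖ ^ 2 : ℝ) : ℂ)⁻¹ = m := by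
      rw [← hr]
      refine hq.symm.trans ?_
      rw [← hm]
      simp
    exact_mod_cast h
  have hlog : n * |Real.log (‖β‖ ^ 2)| = 2 * d * |(Real.log |e|)| := by
    have h := congrArg (fun x => |Real.log x|) hnormβ
    simp only [Real.log_pow, abs_mul, Nat.abs_cast] at h ⊢
    push_cast at h ⊢
    rw [← h]
    ring
  have hr1 : ‖β‖ ^ 2 ≠ 1 := by
    intro h
    rw [pow_mul, h, one_pow] at hnormβ
    exact he1 ((pow_eq_one_iff_of_nonneg (abs_nonneg e) (by omega)).1 hnormβ.symm)
  rw [← hlog]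
  gcongr
  exact log_two_le_abs_log_of_add_inv_eq_int (by positivity) hr1 hrm

/-- The constant coefficient of a monic factor of `X ^ n - a` is, up to sign, a product of `n`-th
roots of `a`. -/
theorem Polynomial.coeff_zero_pow_of_dvd_X_pow_sub_C {E : Type*} [Field E] [IsAlgClosed E]
    {p : Polynomial E} (hp : p.Monic) {n : ℕ} {a : E}
    (hdvd : p ∣ Polynomial.X ^ n - Polynomial.C a) :
    p.coeff 0 ^ (2 * n) = a ^ (2 * p.natDegree) := by
  have hs := IsAlgClosed.splits p
  have hroots : ∀ y ∈ p.roots, y ^ n = a := fun y hy => by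
    have h := (Polynomial.isRoot_of_mem_roots hy).dvd hdvd
    simpa [sub_eq_zero] using h
  have hprod : p.roots.prod ^ n = a ^ p.natDegree := by
    have h := Multiset.prod_map_pow (m := p.roots) (f := fun x => x) (n := n)
    rw [Multiset.map_id'] at h
    rw [← h, Multiset.map_congr (g := fun _ => a) rfl hroots, Multiset.map_const',
      Multiset.prod_replicate, hs.natDegree_eq_card_roots]
  rw [hs.coeff_zero_eq_prod_roots_of_monic hp, mul_pow, mul_comm 2 n, pow_mul p.roots.prod, hprod,
    ← pow_mul, ← pow_mul, mul_comm 2 p.natDegree, mul_left_comm, ← mul_assoc, mul_comm _ 2,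
    pow_mul (-1 : E) 2]
  simp

/-- Let `K ⊂ ℂ` be a real quadratic field and `ε` a norm-one unit of infinite
order, `K_n = K(ζ_n, ε^{1/n})` with `ζ_n = e^{2πi/n}`.  Then there is a
constant `c > 0` with `c·n·φ(n) ≤ [K_n : ℚ] ≤ 2·n·φ(n)` for all `n ≥ 1`. -/
theorem kummer_degree_asymptotics (K : IntermediateField ℚ ℂ)
    (hK2 : Module.finrank ℚ K = 2) (hKreal : ∀ x : K, (x : ℂ).im = 0)
    (ε : K) (hεint : IsIntegral ℤ ε) (hεinv : IsIntegral ℤ (ε⁻¹ : K))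
    (hnorm : Algebra.norm ℚ ε = 1)
    (hord : ∀ k : ℕ, 0 < k → ε ^ k ≠ 1)
    (ζ : ℕ → ℂ) (hζ : ∀ n : ℕ, ζ n = Complex.exp (2 * (Real.pi : ℂ) * Complex.I / n))
    (α : ℕ → ℂ) (hα : ∀ n : ℕ, 1 ≤ n → (α n) ^ n = (ε : ℂ)) :
    ∃ c : ℝ, 0 < c ∧ ∀ n : ℕ, 1 ≤ n →
      c * (n * Nat.totient n) ≤
        (Module.finrank ℚ (K ⊔ adjoin ℚ {ζ n, α n} : IntermediateField ℚ ℂ) : ℝ) ∧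
      (Module.finrank ℚ (K ⊔ adjoin ℚ {ζ n, α n} : IntermediateField ℚ ℂ) : ℝ) ≤
        2 * (n * Nat.totient n) := by
  have : FiniteDimensional ℚ K := Module.finite_of_finrank_pos (by omega)
  obtain ⟨e, he⟩ : ∃ e : ℝ, (e : ℂ) = ε := ⟨(ε : ℂ).re, Complex.ext rfl (hKreal ε).symm⟩
  have heint : IsIntegral ℤ (e : ℂ) := he ▸ hεint.map (K.val.toRingHom.toIntAlgHom)
  have heinv : IsIntegral ℤ ((e : ℂ)⁻¹) := he ▸ hεinv.map (K.val.toRingHom.toIntAlgHom)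
  obtain ⟨b, hb⟩ := exists_sq_add_mul_add_one_eq_zero_of_norm_eq_one hK2 hnorm
  have hbe : e ^ 2 + b * e + 1 = 0 := by
    have h := congrArg (Subtype.val) hb
    have h' : (ε : ℂ) ^ 2 + b * ε + 1 = 0 := by simpa using h
    rw [← he] at h'
    exact_mod_cast h'
  have he1 : |e| ≠ 1 := fun h => by
    refine hord 2 two_pos (Subtype.ext ?_)
    have h2 : e ^ 2 = 1 := by rw [← sq_abs, h, one_pow]
    change (ε : ℂ) ^ 2 = 1
    rw [← he]
    exact_mod_cast h2
  have he0 : e ≠ 0 := by rintro rfl; norm_num at hbe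
  have hlog : 0 < |(Real.log |e|)| :=
    abs_pos.2 (Real.log_ne_zero_of_pos_of_ne_one (abs_pos.2 he0) he1)
  refine ⟨Real.log 2 / (2 * |(Real.log |e|)|), by positivity, fun n hn => ?_⟩
  have hn0 : n ≠ 0 := by omega
  have hprim : IsPrimitiveRoot (ζ n) n := hζ n ▸ Complex.isPrimitiveRoot_exp n hn0
  have hζint : IsIntegral ℚ (ζ n) := (hprim.isIntegral hn).tower_top
  have hαint : IsIntegral ℚ (α n) :=
    (IsIntegral.of_pow (R := ℤ) hn (by rw [hα n hn, ← he]; exact heint)).tower_top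
  have hcyc : Module.finrank ℚ ℚ⟮ζ n⟯ = n.totient := by
    rw [adjoin.finrank hζint, ← Polynomial.cyclotomic_eq_minpoly_rat hprim hn,
      Polynomial.natDegree_cyclotomic]
  have : FiniteDimensional ℚ ℚ⟮ζ n⟯ := adjoin.finiteDimensional hζint
  have : FiniteDimensional ℚ ℚ⟮α n⟯ := adjoin.finiteDimensional hαint
  have hsup : K ⊔ adjoin ℚ {ζ n, α n} = K ⊔ ℚ⟮ζ n⟯ ⊔ ℚ⟮α n⟯ := by
    rw [Set.insert_eq, adjoin_union, sup_assoc]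
  have hroot {L : IntermediateField ℚ ℂ} (hL : (e : ℂ) ∈ L) :
      minpoly L (α n) ∣ Polynomial.X ^ n - Polynomial.C ⟨e, hL⟩ :=
    minpoly.dvd _ _ (by simp [hα n hn, he])
  rw [hsup]
  constructor
  · let L := adjoin ℚ {ζ n, (e : ℂ)}
    have hζL : ℚ⟮ζ n⟯ ≤ L := adjoin.mono _ _ _ (by simp)
    have heL : (e : ℂ) ∈ L := subset_adjoin _ _ (by simp)
    have hLle : L ≤ K ⊔ ℚ⟮ζ n⟯ := by
      rw [adjoin_le_iff]
      rintro x (rfl | rfl)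
      · exact (le_sup_right : _ ≤ K ⊔ _) (mem_adjoin_simple_self ℚ _)
      · exact (le_sup_left : K ≤ _) (he ▸ ε.2)
    have : FiniteDimensional ℚ L :=
      .of_injective (inclusion hLle).toLinearMap (inclusion hLle).injective
    have hαL : IsIntegral L (α n) := hαint.tower_top
    have hd : (minpoly L (α n)).natDegree ≠ 0 := (minpoly.natDegree_pos hαL).ne'
    have hmain := mul_log_two_le_of_pow_eq hbe he1 heint heinv hn0 hd hprim.pow_eq_one
      (β := (minpoly L (α n)).coeff 0) ((minpoly L (α n)).coeff 0).2 (by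
        have h := Polynomial.coeff_zero_pow_of_dvd_X_pow_sub_C
          ((minpoly.monic hαL).map (algebraMap L ℂ)) (n := n) (a := (e : ℂ)) (by
            have := Polynomial.map_dvd (algebraMap L ℂ) (hroot heL)
            simpa using this)
        rw [Polynomial.coeff_map, Polynomial.natDegree_map] at h
        exact h)
    have hle : n.totient * (minpoly L (α n)).natDegree ≤
        Module.finrank ℚ (K ⊔ ℚ⟮ζ n⟯ ⊔ ℚ⟮α n⟯ : IntermediateField ℚ ℂ) :=
      calc
        _ ≤ Module.finrank ℚ L * (minpoly L (α n)).natDegree := by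
          gcongr
          exact hcyc.symm.trans_le (finrank_le_of_le_right hζL)
        _ = Module.finrank ℚ (L ⊔ ℚ⟮α n⟯ : IntermediateField ℚ ℂ) :=
          (finrank_sup_adjoin_simple L hαL).symm
        _ ≤ _ := finrank_le_of_le_right (sup_le_sup_right hLle _)
    calc
      _ = n.totient * (n * Real.log 2 / (2 * |(Real.log |e|)|)) := by ring
      _ ≤ n.totient * ((minpoly L (α n)).natDegree : ℝ) := by
        gcongr
        rw [div_le_iff₀ (by positivity)]
        linarith
      _ ≤ _ := by exact_mod_cast hle
  · have heM : (e : ℂ) ∈ K ⊔ ℚ⟮ζ n⟯ := (le_sup_left : K ≤ _) (he ▸ ε.2)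
    have hdeg := Polynomial.natDegree_le_of_dvd (hroot heM) (Polynomial.X_pow_sub_C_ne_zero hn _)
    rw [Polynomial.natDegree_X_pow_sub_C] at hdeg
    have hM := finrank_sup_le K ℚ⟮ζ n⟯
    rw [hK2, hcyc] at hM
    rw [finrank_sup_adjoin_simple _ hαint.tower_top]
    have := Nat.mul_le_mul hM hdeg
    calc
      _ ≤ ((2 * n.totient * n : ℕ) : ℝ) := by exact_mod_cast this
      _ = _ := by push_cast; ring
end
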